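/- arXiv:2206.12940 — 8 statements merged into one kernel-verified Lean document; each statement's English description precedes it below -/
import Mathlib

section
/- Let g be a two-dimensional Lie algebra over ℝ with basis {X, Y} satisfying [X, Y] = Y. Then for every nonzero element W ∈ g there exists a Lie algebra automorphism φ of g such that φ(span{W}) = span{X} or φ(span{W}) = span{Y}. -/
/-- If `ad x` squares to zero, then `1 + ad x = exp (ad x)` is a Lie algebra automorphism. -/
def LieEquiv.oneAddAd {K L : Type*} [Field K] [NeZero (2 : K)] [LieRing L] [LieAlgebra K L]
    (x : L) (hx : ∀ a : L, ⁅x, ⁅x, a⁆⁆ = 0) : L ≃ₗ⁅K⁆ L where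
  toFun a := a + ⁅x, a⁆
  map_add' a b := by rw [lie_add]; abel
  map_smul' c a := by simp
  map_lie' {a b} := by
    have h : ⁅⁅x, a⁆, ⁅x, b⁆⁆ = 0 := by
      have h2 := hx ⁅a, b⁆
      rw [leibniz_lie x a b, lie_add, leibniz_lie x ⁅x, a⁆ b, leibniz_lie x a ⁅x, b⁆, hx, hx,
        zero_lie, lie_zero, zero_add, add_zero, ← two_smul K] at h2
      exact (smul_eq_zero.mp h2).resolve_left two_ne_zero
    change ⁅a, b⁆ + ⁅x, ⁅a, b⁆⁆ = ⁅a + ⁅x, a⁆, b + ⁅x, b⁆⁆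
    simp only [lie_add, add_lie, h, leibniz_lie x a b]
    abel
  invFun a := a - ⁅x, a⁆
  left_inv a := by simp [hx]
  right_inv a := by simp [hx]

/-- In the two-dimensional Lie algebra with basis `{X, Y}` and `[X, Y] = Y`,
every one-dimensional subspace is conjugate under a Lie algebra automorphism to
`span{X}` or `span{Y}`. -/
theorem stmt_6 (L : Type*) [LieRing L] [LieAlgebra ℝ L]
    (X Y : L) (hli : LinearIndependent ℝ ![X, Y])
    (hspan : Submodule.span ℝ ({X, Y} : Set L) = ⊤)
    (hXY : ⁅X, Y⁆ = Y) :
    ∀ W : L, W ≠ 0 → ∃ φ : L ≃ₗ⁅ℝ⁆ L,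
      Submodule.map φ.toLieHom.toLinearMap (Submodule.span ℝ ({W} : Set L)) =
        Submodule.span ℝ ({X} : Set L) ∨
      Submodule.map φ.toLieHom.toLinearMap (Submodule.span ℝ ({W} : Set L)) =
        Submodule.span ℝ ({Y} : Set L) := by
  intro W hW
  have mem_span (a : L) : ∃ p q : ℝ, p • X + q • Y = a :=
    Submodule.mem_span_pair.mp (hspan ▸ Submodule.mem_top)
  obtain ⟨a, b, rfl⟩ := mem_span W
  have hYX : ⁅Y, X⁆ = -Y := by rw [← lie_skew, hXY]
  by_cases ha : a = 0
  · subst ha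
    have hb : b ≠ 0 := by
      rintro rfl
      simp at hW
    refine ⟨LieEquiv.refl, Or.inr ?_⟩
    rw [Submodule.map_span, Set.image_singleton, ← Submodule.span_singleton_smul_eq hb.isUnit Y]
    simp
  · have hx (c : L) : ⁅(b / a) • Y, ⁅(b / a) • Y, c⁆⁆ = 0 := by
      obtain ⟨p, q, rfl⟩ := mem_span c
      simp [hYX]
    refine ⟨LieEquiv.oneAddAd ((b / a) • Y) hx, Or.inl ?_⟩
    rw [Submodule.map_span, Set.image_singleton,
      ← Submodule.span_singleton_smul_eq (Ne.isUnit ha) X]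
    congr 2
    change a • X + b • Y + ⁅(b / a) • Y, a • X + b • Y⁆ = a • X
    simp [hYX, smul_smul, mul_div_cancel₀, ha]
end

section
/- Let λ, μ be nonzero real numbers with λ ≠ μ, and let g be the three-dimensional Lie algebra over ℝ with basis {X, Y, Z} satisfying [X, Y] = λY, [X, Z] = μZ, and [Y, Z] = 0. Then the nonzero proper Lie ideals of g are exactly span{Y}, span{Z}, and span{Y, Z}. -/
/-- In the three-dimensional Lie algebra with basis `{X, Y, Z}` and relations
`[X,Y] = λY`, `[X,Z] = μZ`, `[Y,Z] = 0` (`λ ≠ μ`, `λμ ≠ 0`), the nonzero proper Lie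
ideals are exactly `span{Y}`, `span{Z}` and `span{Y, Z}`. -/
theorem stmt_7 (L : Type*) [LieRing L] [LieAlgebra ℝ L]
    (lam mu : ℝ) (hlam : lam ≠ 0) (hmu : mu ≠ 0) (hne : lam ≠ mu)
    (X Y Z : L) (hli : LinearIndependent ℝ ![X, Y, Z])
    (hspan : Submodule.span ℝ ({X, Y, Z} : Set L) = ⊤)
    (hXY : ⁅X, Y⁆ = lam • Y) (hXZ : ⁅X, Z⁆ = mu • Z) (hYZ : ⁅Y, Z⁆ = 0) :
    ∀ p : Submodule ℝ L,
      ((∀ x : L, ∀ y ∈ p, ⁅x, y⁆ ∈ p) ∧ p ≠ ⊥ ∧ p ≠ ⊤) ↔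
        (p = Submodule.span ℝ ({Y} : Set L) ∨ p = Submodule.span ℝ ({Z} : Set L) ∨
          p = Submodule.span ℝ ({Y, Z} : Set L)) := by
  have hYX : ⁅Y, X⁆ = -(lam • Y) := by rw [← lie_skew, hXY]
  have hZX : ⁅Z, X⁆ = -(mu • Z) := by rw [← lie_skew, hXZ]
  have hZY : ⁅Z, Y⁆ = 0 := by rw [← lie_skew, hYZ, neg_zero]
  have coords : ∀ v : L, ∃ a b c : ℝ, a • X + b • Y + c • Z = v := by
    intro v
    have hv : v ∈ Submodule.span ℝ ({X, Y, Z} : Set L) := hspan ▸ Submodule.mem_top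
    obtain ⟨a, b, c, h⟩ := Submodule.mem_span_triple.mp hv
    exact ⟨a, b, c, h⟩
  have hY0 : Y ≠ 0 := hli.ne_zero 1
  have hZ0 : Z ≠ 0 := hli.ne_zero 2
  have hX : X ∉ Submodule.span ℝ ({Y, Z} : Set L) := by
    intro h
    obtain ⟨b, c, h⟩ := Submodule.mem_span_pair.mp h
    have := Fintype.linearIndependent_iff.mp hli ![-1, b, c]
      (by simp [Fin.sum_univ_three, ← h, add_assoc]) 0
    norm_num at this
  have bracket : ∀ a b c b' c' : ℝ, ⁅a • X + b • Y + c • Z, b' • Y + c' • Z⁆ =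
      (a * b' * lam) • Y + (a * c' * mu) • Z := by
    intro a b c b' c'
    simp only [add_lie, lie_add, smul_lie, lie_smul, hXY, hXZ, hYZ, hZY, lie_self]
    module
  intro p
  constructor
  · rintro ⟨hI, hbot, htop⟩
    have hsub : ∀ a b c : ℝ, a • X + b • Y + c • Z ∈ p → a = 0 := by
      intro a b c hv
      by_contra ha
      have hYp : Y ∈ p := by
        have h := hI Y _ hv
        have e : ⁅Y, a • X + b • Y + c • Z⁆ = (-(a * lam)) • Y := by
          simp only [lie_add, lie_smul, hYX, hYZ, lie_self]
          module
        rw [e] at h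
        exact (p.smul_mem_iff (neg_ne_zero.mpr (mul_ne_zero ha hlam))).mp h
      have hZp : Z ∈ p := by
        have h := hI Z _ hv
        have e : ⁅Z, a • X + b • Y + c • Z⁆ = (-(a * mu)) • Z := by
          simp only [lie_add, lie_smul, hZX, hZY, lie_self]
          module
        rw [e] at h
        exact (p.smul_mem_iff (neg_ne_zero.mpr (mul_ne_zero ha hmu))).mp h
      have hXp : X ∈ p := by
        rw [p.add_mem_iff_left (p.smul_mem c hZp), p.add_mem_iff_left (p.smul_mem b hYp)] at hv
        exact (p.smul_mem_iff ha).mp hv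
      apply htop
      rw [eq_top_iff, ← hspan, Submodule.span_le]
      rintro _ (rfl | rfl | rfl) <;> assumption
    have hsplit : ∀ b c : ℝ, b • Y + c • Z ∈ p → (b = 0 ∨ Y ∈ p) ∧ (c = 0 ∨ Z ∈ p) := by
      intro b c hv
      have h := hI X _ hv
      have eY : ⁅X, b • Y + c • Z⁆ - mu • (b • Y + c • Z) = ((lam - mu) * b) • Y := by
        simp only [lie_add, lie_smul, hXY, hXZ]
        module
      have eZ : ⁅X, b • Y + c • Z⁆ - lam • (b • Y + c • Z) = ((mu - lam) * c) • Z := by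
        simp only [lie_add, lie_smul, hXY, hXZ]
        module
      have hY := p.sub_mem h (p.smul_mem mu hv)
      have hZ := p.sub_mem h (p.smul_mem lam hv)
      rw [eY] at hY
      rw [eZ] at hZ
      refine ⟨or_iff_not_imp_left.mpr fun hb => ?_, or_iff_not_imp_left.mpr fun hc => ?_⟩
      · exact (p.smul_mem_iff (mul_ne_zero (sub_ne_zero.mpr hne) hb)).mp hY
      · exact (p.smul_mem_iff (mul_ne_zero (sub_ne_zero.mpr hne.symm) hc)).mp hZ
    have hmem : ∀ v ∈ p, ∃ b c : ℝ, b • Y + c • Z = v ∧ (b = 0 ∨ Y ∈ p) ∧ (c = 0 ∨ Z ∈ p) := by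
      intro v hv
      obtain ⟨a, b, c, rfl⟩ := coords v
      obtain rfl := hsub a b c hv
      rw [zero_smul, zero_add] at hv ⊢
      exact ⟨b, c, rfl, hsplit b c hv⟩
    by_cases hY : Y ∈ p <;> by_cases hZ : Z ∈ p
    · refine Or.inr (Or.inr (le_antisymm (fun v hv => ?_) ?_))
      · obtain ⟨b, c, h, -⟩ := hmem v hv
        exact Submodule.mem_span_pair.mpr ⟨b, c, h⟩
      · rw [Submodule.span_le]
        rintro _ (rfl | rfl) <;> assumption
    · refine Or.inl (le_antisymm (fun v hv => ?_) ((Submodule.span_singleton_le_iff_mem _ _).mpr hY))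
      obtain ⟨b, c, rfl, -, hc⟩ := hmem v hv
      obtain rfl := hc.resolve_right hZ
      exact Submodule.mem_span_singleton.mpr ⟨b, by simp⟩
    · refine Or.inr (Or.inl
        (le_antisymm (fun v hv => ?_) ((Submodule.span_singleton_le_iff_mem _ _).mpr hZ)))
      obtain ⟨b, c, rfl, hb, -⟩ := hmem v hv
      obtain rfl := hb.resolve_right hY
      exact Submodule.mem_span_singleton.mpr ⟨c, by simp⟩
    · refine absurd ((Submodule.eq_bot_iff p).mpr fun v hv => ?_) hbot
      obtain ⟨b, c, rfl, hb, hc⟩ := hmem v hv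
      simp [hb.resolve_right hY, hc.resolve_right hZ]
  · have ne_top : ∀ s ⊆ ({Y, Z} : Set L), Submodule.span ℝ s ≠ ⊤ := fun s hs h =>
      hX (Submodule.span_mono hs (h ▸ Submodule.mem_top))
    rintro (rfl | rfl | rfl)
    · refine ⟨fun x y hy => ?_, by simpa using hY0, ne_top _ (by simp)⟩
      obtain ⟨a, b, c, rfl⟩ := coords x
      obtain ⟨d, rfl⟩ := Submodule.mem_span_singleton.mp hy
      have h := bracket a b c d 0
      simp only [zero_smul, add_zero, mul_zero, zero_mul] at h
      exact Submodule.mem_span_singleton.mpr ⟨_, h.symm⟩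
    · refine ⟨fun x y hy => ?_, by simpa using hZ0, ne_top _ (by simp)⟩
      obtain ⟨a, b, c, rfl⟩ := coords x
      obtain ⟨d, rfl⟩ := Submodule.mem_span_singleton.mp hy
      have h := bracket a b c 0 d
      simp only [zero_smul, zero_add, mul_zero, zero_mul] at h
      exact Submodule.mem_span_singleton.mpr ⟨_, h.symm⟩
    · refine ⟨fun x y hy => ?_, fun h => hY0 ?_, ne_top _ subset_rfl⟩
      · obtain ⟨a, b, c, rfl⟩ := coords x
        obtain ⟨d, e, rfl⟩ := Submodule.mem_span_pair.mp hy
        exact Submodule.mem_span_pair.mpr ⟨_, _, (bracket a b c d e).symm⟩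
      · exact Submodule.span_eq_bot.mp h Y (by simp)
end

section
/- Let λ, μ be nonzero real numbers with λ ≠ μ, and let g be the three-dimensional Lie algebra over ℝ with basis {X, Y, Z} satisfying [X, Y] = λY, [X, Z] = μZ, and [Y, Z] = 0. Then for every nonzero element W ∈ g there exists a Lie algebra automorphism φ of g such that φ(span{W}) is one of span{X}, span{Y}, span{Z}, span{Y + Z}, span{Y − Z}. -/
/-- If `⁅X, Y⁆ = lam • Y`, `⁅X, Z⁆ = mu • Z` and `⁅Y, Z⁆ = 0` for a basis `X, Y, Z`, then
`X ↦ X + p • Y + q • Z`, `Y ↦ b • Y`, `Z ↦ c • Z` extends to a Lie algebra automorphism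
whenever `b` and `c` are nonzero. -/
theorem exists_lieEquiv_of_diagonal_bracket {K L : Type*} [Field K] [LieRing L] [LieAlgebra K L]
    {lam mu : K} {X Y Z : L} (hli : LinearIndependent K ![X, Y, Z])
    (hspan : Submodule.span K ({X, Y, Z} : Set L) = ⊤)
    (hXY : ⁅X, Y⁆ = lam • Y) (hXZ : ⁅X, Z⁆ = mu • Z) (hYZ : ⁅Y, Z⁆ = 0)
    (p q : K) {b c : K} (hb : b ≠ 0) (hc : c ≠ 0) :
    ∃ φ : L ≃ₗ⁅K⁆ L, φ X = X + p • Y + q • Z ∧ φ Y = b • Y ∧ φ Z = c • Z := by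
  have exists_coord (w : L) : ∃ r s t : K, r • X + s • Y + t • Z = w := by
    have hw : w ∈ Submodule.span K ({X, Y, Z} : Set L) := hspan ▸ Submodule.mem_top
    obtain ⟨r, s, t, h⟩ := Submodule.mem_span_triple.mp hw
    exact ⟨r, s, t, h⟩
  let e : Module.Basis (Fin 3) K L := Module.Basis.mk hli (by
    rw [← hspan]
    refine Submodule.span_mono ?_
    rintro _ (rfl | rfl | rfl)
    exacts [⟨0, rfl⟩, ⟨1, rfl⟩, ⟨2, rfl⟩])
  have exists_linearMap (u v w : L) : ∃ f : L →ₗ[K] L, f X = u ∧ f Y = v ∧ f Z = w := by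
    refine ⟨e.constr K ![u, v, w], ?_, ?_, ?_⟩
    · simpa [e] using e.constr_basis K ![u, v, w] 0
    · simpa [e] using e.constr_basis K ![u, v, w] 1
    · simpa [e] using e.constr_basis K ![u, v, w] 2
  obtain ⟨f, fX, fY, fZ⟩ := exists_linearMap (X + p • Y + q • Z) (b • Y) (c • Z)
  obtain ⟨g, gX, gY, gZ⟩ :=
    exists_linearMap (X - (p * b⁻¹) • Y - (q * c⁻¹) • Z) (b⁻¹ • Y) (c⁻¹ • Z)
  have hYX : ⁅Y, X⁆ = -(lam • Y) := by rw [← lie_skew, hXY]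
  have hZX : ⁅Z, X⁆ = -(mu • Z) := by rw [← lie_skew, hXZ]
  have hZY : ⁅Z, Y⁆ = 0 := by rw [← lie_skew, hYZ, neg_zero]
  refine ⟨{ f with
    map_lie' := ?_
    invFun := g
    left_inv := ?_
    right_inv := ?_ }, fX, fY, fZ⟩
  · intro x y
    obtain ⟨r, s, t, rfl⟩ := exists_coord x
    obtain ⟨r', s', t', rfl⟩ := exists_coord y
    simp only [AddHom.toFun_eq_coe, LinearMap.coe_toAddHom, map_add, map_smul, map_neg, map_zero,
      lie_add, add_lie, smul_lie, lie_smul, lie_self, hXY, hXZ, hYZ, hYX, hZX, hZY, fX, fY, fZ]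
    module
  · intro x
    obtain ⟨r, s, t, rfl⟩ := exists_coord x
    simp only [AddHom.toFun_eq_coe, LinearMap.coe_toAddHom, map_add, map_smul, fX, fY, fZ,
      gX, gY, gZ]
    match_scalars <;> field_simp <;> ring
  · intro x
    obtain ⟨r, s, t, rfl⟩ := exists_coord x
    simp only [AddHom.toFun_eq_coe, LinearMap.coe_toAddHom, map_add, map_sub, map_smul, fX, fY, fZ,
      gX, gY, gZ]
    match_scalars <;> field_simp <;> ring

/-- A Lie algebra morphism sending `W` to a nonzero multiple of `V` maps the line through `W`
onto the line through `V`. -/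
theorem LieHom.map_span_singleton_eq {K L M : Type*} [Field K] [LieRing L] [LieAlgebra K L]
    [LieRing M] [LieAlgebra K M] (φ : L →ₗ⁅K⁆ M) {W : L} {V : M} {a : K} (ha : a ≠ 0)
    (h : φ W = a • V) :
    Submodule.map φ.toLinearMap (Submodule.span K ({W} : Set L)) =
      Submodule.span K ({V} : Set M) := by
  rw [Submodule.map_span, Set.image_singleton, LieHom.coe_toLinearMap, h]
  exact Submodule.span_singleton_smul_eq (IsUnit.mk0 a ha) V


/-- In the three-dimensional Lie algebra with basis `{X, Y, Z}` and relations
`[X,Y] = λY`, `[X,Z] = μZ`, `[Y,Z] = 0` (`λ ≠ μ`, `λμ ≠ 0`), every one-dimensional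
subspace is conjugate under a Lie algebra automorphism to one of `span{X}`, `span{Y}`,
`span{Z}`, `span{Y + Z}`, `span{Y − Z}`. -/
theorem stmt_8 (L : Type*) [LieRing L] [LieAlgebra ℝ L]
    (lam mu : ℝ) (hlam : lam ≠ 0) (hmu : mu ≠ 0) (hne : lam ≠ mu)
    (X Y Z : L) (hli : LinearIndependent ℝ ![X, Y, Z])
    (hspan : Submodule.span ℝ ({X, Y, Z} : Set L) = ⊤)
    (hXY : ⁅X, Y⁆ = lam • Y) (hXZ : ⁅X, Z⁆ = mu • Z) (hYZ : ⁅Y, Z⁆ = 0) :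
    ∀ W : L, W ≠ 0 → ∃ φ : L ≃ₗ⁅ℝ⁆ L,
      Submodule.map φ.toLieHom.toLinearMap (Submodule.span ℝ ({W} : Set L)) =
          Submodule.span ℝ ({X} : Set L) ∨
      Submodule.map φ.toLieHom.toLinearMap (Submodule.span ℝ ({W} : Set L)) =
          Submodule.span ℝ ({Y} : Set L) ∨
      Submodule.map φ.toLieHom.toLinearMap (Submodule.span ℝ ({W} : Set L)) =
          Submodule.span ℝ ({Z} : Set L) ∨
      Submodule.map φ.toLieHom.toLinearMap (Submodule.span ℝ ({W} : Set L)) =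
          Submodule.span ℝ ({Y + Z} : Set L) ∨
      Submodule.map φ.toLieHom.toLinearMap (Submodule.span ℝ ({W} : Set L)) =
          Submodule.span ℝ ({Y - Z} : Set L) := by
  intro W hW
  have hWs : W ∈ Submodule.span ℝ ({X, Y, Z} : Set L) := hspan ▸ Submodule.mem_top
  obtain ⟨a, y, z, rfl⟩ := Submodule.mem_span_triple.mp hWs
  have key := @exists_lieEquiv_of_diagonal_bracket ℝ L _ _ _ lam mu X Y Z hli hspan hXY hXZ hYZ
  by_cases ha : a = 0
  · subst ha
    by_cases hy : y = 0
    · subst hy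
      have hz : z ≠ 0 := by rintro rfl; simp at hW
      refine ⟨LieEquiv.refl, .inr (.inr (.inl ?_))⟩
      exact LieHom.map_span_singleton_eq _ hz (by simp)
    by_cases hz : z = 0
    · subst hz
      refine ⟨LieEquiv.refl, .inr (.inl ?_)⟩
      exact LieHom.map_span_singleton_eq _ hy (by simp)
    obtain ⟨φ, -, φY, φZ⟩ := key 0 0 (inv_ne_zero hy) (inv_ne_zero hz)
    refine ⟨φ, .inr (.inr (.inr (.inl ?_)))⟩
    refine LieHom.map_span_singleton_eq _ one_ne_zero ?_
    simp [φY, φZ, smul_smul, hy, hz]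
  · obtain ⟨φ, φX, φY, φZ⟩ := key (-(y / a)) (-(z / a)) one_ne_zero one_ne_zero
    refine ⟨φ, .inl ?_⟩
    refine LieHom.map_span_singleton_eq _ ha ?_
    simp only [LieEquiv.coe_toLieHom, map_add, map_smul, φX, φY, φZ]
    match_scalars <;> field_simp <;> ring
end

section
/- Let λ, μ be nonzero real numbers with λ ≠ μ, and let g be the three-dimensional Lie algebra over ℝ with basis {X, Y, Z} satisfying [X, Y] = λY, [X, Z] = μZ, and [Y, Z] = 0. Then for every two-dimensional Lie subalgebra h of g there exists a Lie algebra automorphism φ of g such that φ(h) is one of span{X, Y}, span{X, Z}, span{Y, Z}. -/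
/-- If `ξ` is a linear form vanishing on brackets and on `w`, and `ξ y • ⁅x, w⁆` is symmetric in
`x` and `y`, then the transvection `x ↦ x + ξ x • w` is a Lie algebra automorphism. -/
theorem exists_lieEquiv_add_smul {R L : Type*} [CommRing R] [LieRing L] [LieAlgebra R L]
    (ξ : L →ₗ[R] R) (w : L) (hw : ξ w = 0) (hbr : ∀ x y : L, ξ ⁅x, y⁆ = 0)
    (hsymm : ∀ x y : L, ξ y • ⁅x, w⁆ = ξ x • ⁅y, w⁆) :
    ∃ φ : L ≃ₗ⁅R⁆ L, ∀ x, φ x = x + ξ x • w := by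
  refine ⟨{ toFun := fun x => x + ξ x • w
            invFun := fun x => x - ξ x • w
            map_add' := fun x y => by simp only [map_add, add_smul]; abel
            map_smul' := fun r x => by simp [mul_smul]
            map_lie' := fun {x y} => ?_
            left_inv := fun x => by simp [hw]
            right_inv := fun x => by simp [hw] }, fun x => rfl⟩
  have key : ⁅w, y⁆ = -⁅y, w⁆ := (lie_skew w y).symm
  simp only [hbr, zero_smul, add_zero, lie_add, add_lie, lie_smul, smul_lie, lie_self, smul_zero,
    key, hsymm x y, smul_neg]
  abel

theorem LinearIndependent.finrank_span_pair {K V : Type*} [Field K] [AddCommGroup V]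
    [Module K V] {a b : V} (hab : LinearIndependent K ![a, b]) :
    Module.finrank K (Submodule.span K {a, b}) = 2 := by
  have h := finrank_span_eq_card hab
  rw [Matrix.range_cons_cons_empty] at h
  simpa using h

/-- A two-dimensional subspace is spanned by any two linearly independent vectors in it. -/
theorem Submodule.eq_span_pair_of_finrank_eq_two {K V : Type*} [Field K] [AddCommGroup V]
    [Module K V] {S : Submodule K V} (hS : Module.finrank K S = 2) {a b : V}
    (hab : LinearIndependent K ![a, b]) (ha : a ∈ S) (hb : b ∈ S) :
    S = Submodule.span K {a, b} := by
  have : FiniteDimensional K S := Module.finite_of_finrank_eq_succ hS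
  have hle : Submodule.span K {a, b} ≤ S := by
    rw [Submodule.span_le]
    rintro x (rfl | rfl) <;> assumption
  refine (Submodule.eq_of_le_of_finrank_eq hle (hab.finrank_span_pair.trans hS.symm)).symm

/-- In the three-dimensional Lie algebra with basis `{X, Y, Z}` and relations
`[X,Y] = λY`, `[X,Z] = μZ`, `[Y,Z] = 0` (`λ ≠ μ`, `λμ ≠ 0`), every two-dimensional Lie
subalgebra is conjugate under a Lie algebra automorphism to one of `span{X, Y}`,
`span{X, Z}`, `span{Y, Z}`. -/
theorem stmt_9 (L : Type*) [LieRing L] [LieAlgebra ℝ L]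
    (lam mu : ℝ) (hlam : lam ≠ 0) (hmu : mu ≠ 0) (hne : lam ≠ mu)
    (X Y Z : L) (hli : LinearIndependent ℝ ![X, Y, Z])
    (hspan : Submodule.span ℝ ({X, Y, Z} : Set L) = ⊤)
    (hXY : ⁅X, Y⁆ = lam • Y) (hXZ : ⁅X, Z⁆ = mu • Z) (hYZ : ⁅Y, Z⁆ = 0) :
    ∀ h : LieSubalgebra ℝ L, Module.finrank ℝ h = 2 → ∃ φ : L ≃ₗ⁅ℝ⁆ L,
      Submodule.map φ.toLieHom.toLinearMap h.toSubmodule =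
          Submodule.span ℝ ({X, Y} : Set L) ∨
      Submodule.map φ.toLieHom.toLinearMap h.toSubmodule =
          Submodule.span ℝ ({X, Z} : Set L) ∨
      Submodule.map φ.toLieHom.toLinearMap h.toSubmodule =
          Submodule.span ℝ ({Y, Z} : Set L) := by
  intro h hh
  have hspan' : ⊤ ≤ Submodule.span ℝ (Set.range ![X, Y, Z]) := by
    rw [Matrix.range_cons, Matrix.range_cons_cons_empty, ← hspan]
    rfl
  let B := Module.Basis.mk hli hspan'
  have hB (i : Fin 3) : B i = ![X, Y, Z] i := Module.Basis.mk_apply hli hspan' i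
  have hdec (x : L) : x = B.coord 0 x • X + B.coord 1 x • Y + B.coord 2 x • Z := by
    conv_lhs => rw [← B.sum_repr x, Fin.sum_univ_three]
    simp [hB]
  generalize hξ : B.coord 0 = ξ at hdec
  generalize B.coord 1 = η at hdec
  generalize B.coord 2 = ζ at hdec
  have hξX : ξ X = 1 := by
    rw [← hξ, ← show B 0 = X from hB 0]; simp
  have hξY : ξ Y = 0 := by
    rw [← hξ, ← show B 1 = Y from hB 1]; simp
  have hξZ : ξ Z = 0 := by
    rw [← hξ, ← show B 2 = Z from hB 2]; simp
  have hYX : ⁅Y, X⁆ = -(lam • Y) := by rw [← lie_skew, hXY]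
  have hZX : ⁅Z, X⁆ = -(mu • Z) := by rw [← lie_skew, hXZ]
  have hZY : ⁅Z, Y⁆ = 0 := by rw [← lie_skew, hYZ, neg_zero]
  have hbr (x y : L) : ξ ⁅x, y⁆ = 0 := by
    rw [hdec x, hdec y]
    simp [hXY, hXZ, hYZ, hYX, hZX, hZY, hξY, hξZ]
  have hsub (i j : Fin 3) (hij : i ≠ j) :
      LinearIndependent ℝ ![![X, Y, Z] i, ![X, Y, Z] j] := by
    have := hli.comp ![i, j] (by
      intro a b; fin_cases a <;> fin_cases b <;> simp [hij, hij.symm])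
    convert this using 1
    ext a; fin_cases a <;> rfl
  by_cases hker : ∀ x ∈ h, ξ x = 0
  · refine ⟨LieEquiv.refl, Or.inr (Or.inr ?_)⟩
    have hle : h.toSubmodule ≤ Submodule.span ℝ {Y, Z} := fun x hx => by
      rw [Submodule.mem_span_pair]
      refine ⟨η x, ζ x, ?_⟩
      conv_rhs => rw [hdec x, hker x hx]
      simp
    have : FiniteDimensional ℝ (Submodule.span ℝ ({Y, Z} : Set L)) :=
      FiniteDimensional.span_of_finite ℝ (Set.toFinite _)
    have heq := Submodule.eq_of_le_of_finrank_eq hle 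
      (hh.trans (hsub 1 2 (by decide)).finrank_span_pair.symm)
    rw [← heq]
    exact Submodule.map_id _
  · push Not at hker
    obtain ⟨v₀, hv₀, hξv₀⟩ := hker
    obtain ⟨v, hv, hξv⟩ : ∃ v ∈ h, ξ v = 1 :=
      ⟨(ξ v₀)⁻¹ • v₀, h.smul_mem _ hv₀, by simp [hξv₀]⟩
    obtain ⟨u₀, hu₀, hu₀v⟩ : ∃ u ∈ h, u ∉ Submodule.span ℝ {v} := by
      by_contra! hcon
      have h1 : Module.finrank ℝ h.toSubmodule ≤ Module.finrank ℝ (Submodule.span ℝ {v}) :=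
        Submodule.finrank_mono hcon
      have h2 := finrank_span_le_card (R := ℝ) ({v} : Set L)
      have h3 : Module.finrank ℝ h.toSubmodule = 2 := hh
      simp at h2
      omega
    obtain ⟨u, hu, hu0, hξu⟩ : ∃ u ∈ h, u ≠ 0 ∧ ξ u = 0 := by
      refine ⟨u₀ - ξ u₀ • v, h.sub_mem hu₀ (h.smul_mem _ hv), fun h0 => hu₀v ?_, by simp [hξv]⟩
      rw [Submodule.mem_span_singleton]
      exact ⟨ξ u₀, (sub_eq_zero.mp h0).symm⟩
    have hvdec := hdec v
    have hudec := hdec u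
    rw [hξv, one_smul] at hvdec
    rw [hξu, zero_smul, zero_add] at hudec
    have hvu : ⁅v, u⁆ = (lam * η u) • Y + (mu * ζ u) • Z := by
      nth_rw 1 [hvdec, hudec]
      simp only [lie_add, add_lie, lie_smul, smul_lie, hXY, hXZ, hYZ, hZY, lie_self]
      module
    have hmem : ⁅v, u⁆ ∈ h := h.lie_mem hv hu
    have hYm : η u ≠ 0 → Y ∈ h := fun hy => by
      have h1 : ((lam - mu) * η u) • Y ∈ h := by
        have : ((lam - mu) * η u) • Y = ⁅v, u⁆ - mu • u := by
          linear_combination (norm := module) mu • hudec - hvu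
        rw [this]
        exact h.sub_mem hmem (h.smul_mem _ hu)
      exact (h.toSubmodule.smul_mem_iff (mul_ne_zero (sub_ne_zero.mpr hne) hy)).mp h1
    have hZm : ζ u ≠ 0 → Z ∈ h := fun hz => by
      have h1 : ((mu - lam) * ζ u) • Z ∈ h := by
        have : ((mu - lam) * ζ u) • Z = ⁅v, u⁆ - lam • u := by
          linear_combination (norm := module) lam • hudec - hvu
        rw [this]
        exact h.sub_mem hmem (h.smul_mem _ hu)
      exact (h.toSubmodule.smul_mem_iff (mul_ne_zero (sub_ne_zero.mpr hne.symm) hz)).mp h1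
    obtain ⟨φ, hφ⟩ := exists_lieEquiv_add_smul ξ (X - v) (by simp [hξX, hξv]) hbr (by
      intro x y
      have hw : X - v = -(η v • Y + ζ v • Z) := by nth_rw 1 [hvdec]; abel
      have hxw (x : L) : ⁅x, X - v⁆ = -(ξ x • ((lam * η v) • Y + (mu * ζ v) • Z)) := by
        rw [hw]
        nth_rw 1 [hdec x]
        simp only [lie_neg, lie_add, add_lie, lie_smul, smul_lie, hXY, hXZ, hYZ, hZY, lie_self]
        module
      rw [hxw, hxw]
      module)
    have hX : X ∈ Submodule.map φ.toLieHom.toLinearMap h.toSubmodule :=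
      ⟨v, hv, by change φ v = X; simp [hφ, hξv]⟩
    have hfix {e : L} (he : e ∈ h) (hξe : ξ e = 0) :
        e ∈ Submodule.map φ.toLieHom.toLinearMap h.toSubmodule :=
      ⟨e, he, by change φ e = e; simp [hφ, hξe]⟩
    have hrank : Module.finrank ℝ (Submodule.map φ.toLieHom.toLinearMap h.toSubmodule) = 2 :=
      (LinearEquiv.finrank_map_eq φ.toLinearEquiv h.toSubmodule).trans hh
    refine ⟨φ, ?_⟩
    by_cases hy : η u = 0
    · have hz : ζ u ≠ 0 := fun hz => hu0 (by rw [hudec, hy, hz]; simp)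
      exact Or.inr (Or.inl (Submodule.eq_span_pair_of_finrank_eq_two hrank
        (hsub 0 2 (by decide)) hX (hfix (hZm hz) hξZ)))
    · exact Or.inl (Submodule.eq_span_pair_of_finrank_eq_two hrank
        (hsub 0 1 (by decide)) hX (hfix (hYm hy) hξY))
end

section
/- Let a, b be real numbers with b ≠ 0, and let g be the three-dimensional Lie algebra over ℝ with basis {X, Y, Z} satisfying [X, Y] = aY + bZ, [X, Z] = −bY + aZ, and [Y, Z] = 0. Then the only nonzero proper Lie ideal of g is span{Y, Z}; in particular, g has no one-dimensional Lie ideal. -/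
section

variable {L : Type*} [LieRing L] [LieAlgebra ℝ L] {a b : ℝ} {X Y Z : L} {p : Submodule ℝ L}

/-- A subspace stable under `ad X` that contains a nonzero vector of `span {Y, Z}`
contains both `Y` and `Z`. -/
lemma mem_and_mem_of_combination_mem (hb : b ≠ 0)
    (hXY : ⁅X, Y⁆ = a • Y + b • Z) (hXZ : ⁅X, Z⁆ = -b • Y + a • Z)
    (hp : ∀ w ∈ p, ⁅X, w⁆ ∈ p) {y z : ℝ} (hyz : y ≠ 0 ∨ z ≠ 0)
    (hw : y • Y + z • Z ∈ p) : Y ∈ p ∧ Z ∈ p := by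
  have hn : y ^ 2 + z ^ 2 ≠ 0 := by
    rcases hyz with h | h <;> positivity
  have hrot : y • Z - z • Y ∈ p := by
    have h := p.sub_mem (hp _ hw) (p.smul_mem a hw)
    rw [lie_add, lie_smul, lie_smul, hXY, hXZ] at h
    rw [← p.smul_mem_iff hb]
    convert h using 1
    module
  constructor
  · rw [← p.smul_mem_iff hn]
    convert p.sub_mem (p.smul_mem y hw) (p.smul_mem z hrot) using 1
    module
  · rw [← p.smul_mem_iff hn]
    convert p.add_mem (p.smul_mem z hw) (p.smul_mem y hrot) using 1
    module

lemma exists_eq_combination (hspan : Submodule.span ℝ ({X, Y, Z} : Set L) = ⊤) (v : L) :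
    ∃ x y z : ℝ, v = x • X + y • Y + z • Z := by
  have hv : v ∈ Submodule.span ℝ ({X, Y, Z} : Set L) := hspan ▸ Submodule.mem_top
  obtain ⟨x, y, z, h⟩ := Submodule.mem_span_triple.1 hv
  exact ⟨x, y, z, h.symm⟩

/-- Every nonzero ideal contains `Y` and `Z`. -/
lemma mem_and_mem_of_ideal_ne_bot (hb : b ≠ 0)
    (hspan : Submodule.span ℝ ({X, Y, Z} : Set L) = ⊤)
    (hXY : ⁅X, Y⁆ = a • Y + b • Z) (hXZ : ⁅X, Z⁆ = -b • Y + a • Z) (hYZ : ⁅Y, Z⁆ = 0)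
    (hp : ∀ x : L, ∀ y ∈ p, ⁅x, y⁆ ∈ p) (hbot : p ≠ ⊥) : Y ∈ p ∧ Z ∈ p := by
  obtain ⟨v, hv, hv0⟩ := p.ne_bot_iff.1 hbot
  obtain ⟨x, y, z, rfl⟩ := exists_eq_combination hspan v
  by_cases hx : x = 0
  · subst hx
    rw [zero_smul, zero_add] at hv hv0
    refine mem_and_mem_of_combination_mem hb hXY hXZ (hp X) ?_ hv
    by_contra! h
    exact hv0 (by simp [h.1, h.2])
  · refine mem_and_mem_of_combination_mem (y := -x * a) (z := -x * b) hb hXY hXZ (hp X)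
      (Or.inr (by simp [hx, hb])) ?_
    have h := hp Y _ hv
    rw [lie_add, lie_add, lie_smul, lie_smul, lie_smul, hYZ, lie_self, ← lie_skew, hXY] at h
    convert h using 1
    module

/-- The plane `span {Y, Z}` is an ideal. -/
lemma lie_mem_span_pair (hspan : Submodule.span ℝ ({X, Y, Z} : Set L) = ⊤)
    (hXY : ⁅X, Y⁆ = a • Y + b • Z) (hXZ : ⁅X, Z⁆ = -b • Y + a • Z) (hYZ : ⁅Y, Z⁆ = 0)
    (v w : L) (hw : w ∈ Submodule.span ℝ ({Y, Z} : Set L)) :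
    ⁅v, w⁆ ∈ Submodule.span ℝ ({Y, Z} : Set L) := by
  obtain ⟨x, y, z, rfl⟩ := exists_eq_combination hspan v
  obtain ⟨s, t, rfl⟩ := Submodule.mem_span_pair.1 hw
  have hZY : ⁅Z, Y⁆ = 0 := by rw [← lie_skew, hYZ, neg_zero]
  refine Submodule.mem_span_pair.2 ⟨x * (s * a - t * b), x * (s * b + t * a), ?_⟩
  simp only [add_lie, lie_add, smul_lie, lie_smul, lie_self, hXY, hXZ, hYZ, hZY]
  module

lemma coeffs_eq_zero (hli : LinearIndependent ℝ ![X, Y, Z]) {x y z : ℝ}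
    (h : x • X + y • Y + z • Z = 0) : x = 0 ∧ y = 0 ∧ z = 0 := by
  have h' := Fintype.linearIndependent_iff.1 hli ![x, y, z]
    (by simpa [Fin.sum_univ_three] using h)
  exact ⟨h' 0, h' 1, h' 2⟩

end


/-- In the three-dimensional Lie algebra with basis `{X, Y, Z}` and relations
`[X,Y] = aY + bZ`, `[X,Z] = −bY + aZ`, `[Y,Z] = 0` (`b ≠ 0`), the only nonzero proper Lie
ideal is `span{Y, Z}`; in particular there is no one-dimensional Lie ideal. -/
theorem stmt_10 (L : Type*) [LieRing L] [LieAlgebra ℝ L]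
    (a b : ℝ) (hb : b ≠ 0)
    (X Y Z : L) (hli : LinearIndependent ℝ ![X, Y, Z])
    (hspan : Submodule.span ℝ ({X, Y, Z} : Set L) = ⊤)
    (hXY : ⁅X, Y⁆ = a • Y + b • Z) (hXZ : ⁅X, Z⁆ = -b • Y + a • Z) (hYZ : ⁅Y, Z⁆ = 0) :
    (∀ p : Submodule ℝ L,
      ((∀ x : L, ∀ y ∈ p, ⁅x, y⁆ ∈ p) ∧ p ≠ ⊥ ∧ p ≠ ⊤) ↔
        p = Submodule.span ℝ ({Y, Z} : Set L)) ∧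
    (∀ p : Submodule ℝ L, (∀ x : L, ∀ y ∈ p, ⁅x, y⁆ ∈ p) →
      Module.finrank ℝ p ≠ 1) := by
  have hY0 : Y ≠ 0 := hli.ne_zero 1
  refine ⟨fun p => ⟨?_, ?_⟩, fun p hp hrank => ?_⟩
  · rintro ⟨hp, hbot, htop⟩
    obtain ⟨hY, hZ⟩ := mem_and_mem_of_ideal_ne_bot hb hspan hXY hXZ hYZ hp hbot
    refine le_antisymm (fun v hv => ?_)
      (Submodule.span_le.2 (by simp [Set.insert_subset_iff, hY, hZ]))
    obtain ⟨x, y, z, rfl⟩ := exists_eq_combination hspan v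
    by_cases hx : x = 0
    · exact Submodule.mem_span_pair.2 ⟨y, z, by simp [hx]⟩
    · have hX : X ∈ p := by
        rw [← p.smul_mem_iff hx]
        convert p.sub_mem hv (p.add_mem (p.smul_mem y hY) (p.smul_mem z hZ)) using 1
        module
      refine absurd (top_le_iff.1 ?_) htop
      rw [← hspan, Submodule.span_le]
      simp [Set.insert_subset_iff, hX, hY, hZ]
  · rintro rfl
    refine ⟨lie_mem_span_pair hspan hXY hXZ hYZ, fun h => hY0 ?_, fun h => ?_⟩
    · rw [← Submodule.mem_bot ℝ, ← h]
      exact Submodule.subset_span (by simp)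
    · have hX : X ∈ Submodule.span ℝ ({Y, Z} : Set L) := h ▸ Submodule.mem_top
      obtain ⟨s, t, hst⟩ := Submodule.mem_span_pair.1 hX
      have h0 : (-1 : ℝ) • X + s • Y + t • Z = 0 := by
        rw [← hst]
        module
      linarith [(coeffs_eq_zero hli h0).1]
  · have hbot : p ≠ ⊥ := by
      rintro rfl
      simp at hrank
    obtain ⟨hY, hZ⟩ := mem_and_mem_of_ideal_ne_bot hb hspan hXY hXZ hYZ hp hbot
    obtain ⟨c, hc⟩ := exists_smul_eq_of_finrank_eq_one hrank
      (x := (⟨Y, hY⟩ : p)) (by simpa using hY0) ⟨Z, hZ⟩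
    have hc' : c • Y = Z := congrArg Subtype.val hc
    have h0 : (0 : ℝ) • X + c • Y + (-1 : ℝ) • Z = 0 := by
      rw [← hc']
      module
    linarith [(coeffs_eq_zero hli h0).2.2]
end

section
/- Let g be the three-dimensional Lie algebra over ℝ with basis {X, Y, Z} satisfying [X, Y] = Z, [X, Z] = −Y, and [Y, Z] = 0. Then for every nonzero element W ∈ g there exists a Lie algebra automorphism φ of g such that φ(span{W}) = span{X} or φ(span{W}) = span{Y}. -/
/-- A linear map that respects the Lie bracket on a basis respects it everywhere. -/
theorem Module.Basis.map_lie_of_forall {ι R L L' : Type*} [CommRing R] [LieRing L] [LieAlgebra R L]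
    [LieRing L'] [LieAlgebra R L'] (b : Module.Basis ι R L) (f : L →ₗ[R] L')
    (h : ∀ i j, f ⁅b i, b j⁆ = ⁅f (b i), f (b j)⁆) (x y : L) : f ⁅x, y⁆ = ⁅f x, f y⁆ := by
  have key : (LieModule.toEnd R L L : L →ₗ[R] L →ₗ[R] L).compr₂ f =
      (LieModule.toEnd R L' L' : L' →ₗ[R] L' →ₗ[R] L').compl₁₂ f f :=
    b.ext fun i => b.ext fun j => by simpa using h i j
  simpa using LinearMap.congr_fun₂ key x y

/-- The automorphisms `X ↦ X + uY + vZ`, `Y ↦ pY + qZ`, `Z ↦ -qY + pZ` of the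
Lie algebra with `[X,Y] = Z`, `[X,Z] = -Y`, `[Y,Z] = 0`. -/
theorem exists_lieEquiv_of_sq_add_sq_ne_zero {K L : Type*} [Field K] [LieRing L] [LieAlgebra K L]
    {X Y Z : L} (hli : LinearIndependent K ![X, Y, Z])
    (hspan : Submodule.span K ({X, Y, Z} : Set L) = ⊤)
    (hXY : ⁅X, Y⁆ = Z) (hXZ : ⁅X, Z⁆ = -Y) (hYZ : ⁅Y, Z⁆ = 0)
    (u v p q : K) (hpq : p ^ 2 + q ^ 2 ≠ 0) :
    ∃ φ : L ≃ₗ⁅K⁆ L, φ X = X + u • Y + v • Z ∧ φ Y = p • Y + q • Z ∧ φ Z = -q • Y + p • Z := by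
  have hspan' : ⊤ ≤ Submodule.span K (Set.range ![X, Y, Z]) := by
    rw [← hspan, Matrix.range_cons, Matrix.range_cons, Matrix.range_cons, Matrix.range_empty,
      Set.union_empty, Set.singleton_union, Set.singleton_union]
  let b := Module.Basis.mk hli hspan'
  let f : L →ₗ[K] L := b.constr K ![X + u • Y + v • Z, p • Y + q • Z, -q • Y + p • Z]
  have hf (i : Fin 3) : f (![X, Y, Z] i) =
      ![X + u • Y + v • Z, p • Y + q • Z, -q • Y + p • Z] i := by
    rw [← Module.Basis.mk_apply hli hspan' i]
    exact b.constr_basis K _ i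
  have hX : f X = X + u • Y + v • Z := hf 0
  have hY : f Y = p • Y + q • Z := hf 1
  have hZ : f Z = -q • Y + p • Z := hf 2
  have hYX : ⁅Y, X⁆ = -Z := by rw [← lie_skew, hXY]
  have hZX : ⁅Z, X⁆ = Y := by rw [← lie_skew, hXZ, neg_neg]
  have hZY : ⁅Z, Y⁆ = 0 := by rw [← lie_skew, hYZ, neg_zero]
  have hlie : ∀ x y, f ⁅x, y⁆ = ⁅f x, f y⁆ := by
    refine b.map_lie_of_forall f fun i j => ?_
    fin_cases i <;> fin_cases j <;>
      simp [b, hX, hY, hZ, hXY, hXZ, hYZ, hYX, hZX, hZY] <;> module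
  have hYr : Y ∈ LinearMap.range f := by
    refine ⟨(p ^ 2 + q ^ 2)⁻¹ • (p • Y - q • Z), ?_⟩
    simp only [map_smul, map_sub, hY, hZ]
    match_scalars <;> field_simp <;> ring
  have hZr : Z ∈ LinearMap.range f := by
    refine ⟨(p ^ 2 + q ^ 2)⁻¹ • (q • Y + p • Z), ?_⟩
    simp only [map_smul, map_add, hY, hZ]
    match_scalars <;> field_simp <;> ring
  have hXr : X ∈ LinearMap.range f := by
    have h := sub_mem (sub_mem (LinearMap.mem_range_self f X) (Submodule.smul_mem _ u hYr))
      (Submodule.smul_mem _ v hZr)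
    rw [hX] at h
    convert h using 1
    module
  have hsurj : Function.Surjective f := by
    rw [← LinearMap.range_eq_top, eq_top_iff, ← hspan, Submodule.span_le]
    rintro _ (rfl | rfl | rfl)
    exacts [hXr, hYr, hZr]
  have : FiniteDimensional K L := Module.Basis.finiteDimensional_of_finite b
  exact ⟨LieEquiv.ofBijective { f with map_lie' := hlie _ _ }
    ⟨LinearMap.injective_iff_surjective.mpr hsurj, hsurj⟩, hX, hY, hZ⟩

/-- In the three-dimensional Lie algebra with basis `{X, Y, Z}` and relations
`[X,Y] = Z`, `[X,Z] = −Y`, `[Y,Z] = 0`, every one-dimensional subspace is conjugate under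
a Lie algebra automorphism to `span{X}` or `span{Y}`. -/
theorem stmt_11 (L : Type*) [LieRing L] [LieAlgebra ℝ L]
    (X Y Z : L) (hli : LinearIndependent ℝ ![X, Y, Z])
    (hspan : Submodule.span ℝ ({X, Y, Z} : Set L) = ⊤)
    (hXY : ⁅X, Y⁆ = Z) (hXZ : ⁅X, Z⁆ = -Y) (hYZ : ⁅Y, Z⁆ = 0) :
    ∀ W : L, W ≠ 0 → ∃ φ : L ≃ₗ⁅ℝ⁆ L,
      Submodule.map φ.toLieHom.toLinearMap (Submodule.span ℝ ({W} : Set L)) =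
          Submodule.span ℝ ({X} : Set L) ∨
      Submodule.map φ.toLieHom.toLinearMap (Submodule.span ℝ ({W} : Set L)) =
          Submodule.span ℝ ({Y} : Set L) := by
  intro W hW
  have hmap (φ : L ≃ₗ⁅ℝ⁆ L) (V : L) (r : ℝ) (hr : r ≠ 0) (h : φ W = r • V) :
      Submodule.map φ.toLieHom.toLinearMap (Submodule.span ℝ {W}) = Submodule.span ℝ {V} := by
    rw [Submodule.map_span, Set.image_singleton]
    change Submodule.span ℝ {φ W} = _
    rw [h, Submodule.span_singleton_smul_eq hr.isUnit]
  obtain ⟨a, b, c, rfl⟩ := Submodule.mem_span_triple.mp (hspan ▸ Submodule.mem_top (x := W))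
  by_cases ha : a = 0
  · subst ha
    have hbc : b ^ 2 + c ^ 2 ≠ 0 := by
      intro h
      obtain rfl : b = 0 := by nlinarith
      obtain rfl : c = 0 := by nlinarith
      simp at hW
    obtain ⟨φ, -, hY, hZ⟩ := exists_lieEquiv_of_sq_add_sq_ne_zero hli hspan hXY hXZ hYZ
      0 0 b (-c) (by simpa using hbc)
    refine ⟨φ, .inr (hmap φ Y _ hbc ?_)⟩
    simp only [map_add, map_smul, hY, hZ]
    module
  · obtain ⟨φ, hX, hY, hZ⟩ := exists_lieEquiv_of_sq_add_sq_ne_zero hli hspan hXY hXZ hYZ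
      (-(b / a)) (-(c / a)) 1 0 (by simp)
    refine ⟨φ, .inl (hmap φ X a ha ?_)⟩
    simp only [map_add, map_smul, hX, hY, hZ]
    match_scalars <;> field_simp <;> ring
end

section
/- Let a, b be real numbers with b ≠ 0, and let g be the three-dimensional Lie algebra over ℝ with basis {X, Y, Z} satisfying [X, Y] = aY + bZ, [X, Z] = −bY + aZ, and [Y, Z] = 0. Then the only two-dimensional Lie subalgebra of g is span{Y, Z}. -/
/-- In the three-dimensional Lie algebra with basis `{X, Y, Z}` and relations
`[X,Y] = aY + bZ`, `[X,Z] = −bY + aZ`, `[Y,Z] = 0` (`b ≠ 0`), the only two-dimensional Lie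
subalgebra is `span{Y, Z}`. -/
theorem stmt_12 (L : Type*) [LieRing L] [LieAlgebra ℝ L]
    (a b : ℝ) (hb : b ≠ 0)
    (X Y Z : L) (hli : LinearIndependent ℝ ![X, Y, Z])
    (hspan : Submodule.span ℝ ({X, Y, Z} : Set L) = ⊤)
    (hXY : ⁅X, Y⁆ = a • Y + b • Z) (hXZ : ⁅X, Z⁆ = -b • Y + a • Z) (hYZ : ⁅Y, Z⁆ = 0) :
    ∀ p : Submodule ℝ L, Module.finrank ℝ p = 2 →
      ((∀ x ∈ p, ∀ y ∈ p, ⁅x, y⁆ ∈ p) ↔ p = Submodule.span ℝ ({Y, Z} : Set L)) := by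
  intro p hp
  have : Module.Finite ℝ L := ⟨Submodule.fg_def.mpr ⟨{X, Y, Z}, Set.toFinite _, hspan⟩⟩
  have hZY : ⁅Z, Y⁆ = 0 := by rw [← lie_skew, hYZ, neg_zero]
  have hL : Module.finrank ℝ L ≤ 3 := by
    have h := finrank_range_le_card (R := ℝ) ![X, Y, Z]
    have hr : Set.range ![X, Y, Z] = {X, Y, Z} := by
      simp only [Matrix.range_cons, Matrix.range_empty, Set.union_empty, Set.singleton_union]
    rw [Set.finrank, hr, hspan, finrank_top] at h
    simpa using h
  have hV : Module.finrank ℝ (Submodule.span ℝ ({Y, Z} : Set L)) = 2 := by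
    have hYZli : LinearIndependent ℝ ![Y, Z] :=
      hli.comp Fin.succ (Fin.succ_injective 2)
    have h := finrank_span_eq_card hYZli
    have hr : Set.range ![Y, Z] = {Y, Z} := by
      simp only [Matrix.range_cons, Matrix.range_empty, Set.union_empty, Set.singleton_union]
    rw [hr] at h
    simpa using h
  constructor
  · intro hclosed
    by_cases hle : p ≤ Submodule.span ℝ ({Y, Z} : Set L)
    · exact Submodule.eq_of_le_of_finrank_eq hle (hp.trans hV.symm)
    obtain ⟨v, hv, hvV⟩ := SetLike.not_le_iff_exists.mp hle
    have hvT : v ∈ Submodule.span ℝ ({X, Y, Z} : Set L) := hspan ▸ Submodule.mem_top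
    obtain ⟨x, y, z, rfl⟩ := Submodule.mem_span_triple.mp hvT
    have hx : x ≠ 0 := by
      rintro rfl
      exact hvV (Submodule.mem_span_pair.mpr ⟨y, z, by simp⟩)
    have hinf : p ⊓ Submodule.span ℝ ({Y, Z} : Set L) ≠ ⊥ := by
      intro h
      have hadd := Submodule.finrank_sup_add_finrank_inf_eq p (Submodule.span ℝ ({Y, Z} : Set L))
      have hsup := Submodule.finrank_le (p ⊔ Submodule.span ℝ ({Y, Z} : Set L))
      rw [h, finrank_bot] at hadd
      omega
    obtain ⟨w, ⟨hwp, hwV⟩, hw⟩ := Submodule.exists_mem_ne_zero_of_ne_bot hinf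
    obtain ⟨c, d, rfl⟩ := Submodule.mem_span_pair.mp hwV
    have hcd : c ^ 2 + d ^ 2 ≠ 0 := by
      intro h
      have hc : c = 0 := by nlinarith [sq_nonneg c, sq_nonneg d]
      have hd : d = 0 := by nlinarith [sq_nonneg c, sq_nonneg d]
      simp [hc, hd] at hw
    have hrot : (-d) • Y + c • Z ∈ p := by
      have hbr := p.sub_mem (hclosed _ hv _ hwp) (p.smul_mem (x * a) hwp)
      have heq : ⁅x • X + y • Y + z • Z, c • Y + d • Z⁆ - (x * a) • (c • Y + d • Z)
          = (x * b) • ((-d) • Y + c • Z) := by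
        simp only [add_lie, lie_add, smul_lie, lie_smul, hXY, hXZ, hYZ, hZY, lie_self]
        module
      rw [heq] at hbr
      exact (p.smul_mem_iff (mul_ne_zero hx hb)).mp hbr
    have hYp : Y ∈ p := by
      refine (p.smul_mem_iff hcd).mp ?_
      convert p.sub_mem (p.smul_mem c hwp) (p.smul_mem d hrot) using 1
      module
    have hZp : Z ∈ p := by
      refine (p.smul_mem_iff hcd).mp ?_
      convert p.add_mem (p.smul_mem d hwp) (p.smul_mem c hrot) using 1
      module
    have hVp : Submodule.span ℝ ({Y, Z} : Set L) ≤ p :=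
      Submodule.span_le.mpr (Set.pair_subset hYp hZp)
    exact (Submodule.eq_of_le_of_finrank_eq hVp (hV.trans hp.symm)).symm
  · rintro rfl u hu v hv
    obtain ⟨c, d, rfl⟩ := Submodule.mem_span_pair.mp hu
    obtain ⟨e, f, rfl⟩ := Submodule.mem_span_pair.mp hv
    simp [hYZ, hZY]
end

section
/- Let g be the four-dimensional Lie algebra over ℝ with basis {e₁, e₂, e₃, e₄} and nonzero bracket relations [e₁, e₂] = −2e₁, [e₁, e₃] = −e₄, [e₂, e₃] = −3e₃, [e₂, e₄] = −e₄ (all other brackets of basis elements are zero). Then the nonzero proper Lie ideals of g are exactly span{e₄}, span{e₁, e₄}, span{e₃, e₄}, and span{e₁, e₃, e₄}. -/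
/-- In the four-dimensional Lie algebra with basis `{e₁, e₂, e₃, e₄}` and
nonzero brackets `[e₁,e₂] = −2e₁`, `[e₁,e₃] = −e₄`, `[e₂,e₃] = −3e₃`, `[e₂,e₄] = −e₄`,
the nonzero proper Lie ideals are exactly `span{e₄}`, `span{e₁, e₄}`, `span{e₃, e₄}` and
`span{e₁, e₃, e₄}`. -/
theorem stmt_16 (L : Type*) [LieRing L] [LieAlgebra ℝ L]
    (e₁ e₂ e₃ e₄ : L) (hli : LinearIndependent ℝ ![e₁, e₂, e₃, e₄])
    (hspan : Submodule.span ℝ ({e₁, e₂, e₃, e₄} : Set L) = ⊤)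
    (h12 : ⁅e₁, e₂⁆ = (-2 : ℝ) • e₁) (h13 : ⁅e₁, e₃⁆ = -e₄) (h14 : ⁅e₁, e₄⁆ = 0)
    (h23 : ⁅e₂, e₃⁆ = (-3 : ℝ) • e₃) (h24 : ⁅e₂, e₄⁆ = -e₄) (h34 : ⁅e₃, e₄⁆ = 0) :
    ∀ p : Submodule ℝ L,
      ((∀ x : L, ∀ y ∈ p, ⁅x, y⁆ ∈ p) ∧ p ≠ ⊥ ∧ p ≠ ⊤) ↔
        (p = Submodule.span ℝ ({e₄} : Set L) ∨
          p = Submodule.span ℝ ({e₁, e₄} : Set L) ∨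
          p = Submodule.span ℝ ({e₃, e₄} : Set L) ∨
          p = Submodule.span ℝ ({e₁, e₃, e₄} : Set L)) := by
  have h21 : ⁅e₂, e₁⁆ = (2 : ℝ) • e₁ := by rw [← lie_skew, h12]; module
  have h31 : ⁅e₃, e₁⁆ = e₄ := by rw [← lie_skew, h13]; module
  have h32 : ⁅e₃, e₂⁆ = (3 : ℝ) • e₃ := by rw [← lie_skew, h23]; module
  have h41 : ⁅e₄, e₁⁆ = 0 := by rw [← lie_skew, h14, neg_zero]
  have h43 : ⁅e₄, e₃⁆ = 0 := by rw [← lie_skew, h34, neg_zero]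
  have coords (x : L) : ∃ a b c d : ℝ, x = a • e₁ + b • e₂ + c • e₃ + d • e₄ := by
    have hx : x ∈ Submodule.span ℝ ({e₁, e₂, e₃, e₄} : Set L) := hspan ▸ Submodule.mem_top
    simp only [Submodule.mem_span_insert, Submodule.mem_span_singleton] at hx
    obtain ⟨a, _, ⟨b, _, ⟨c, _, ⟨d, rfl⟩, rfl⟩, rfl⟩, rfl⟩ := hx
    exact ⟨a, b, c, d, by module⟩
  have he₄ : e₄ ≠ 0 := hli.ne_zero 3
  have he₂ : e₂ ∉ Submodule.span ℝ ({e₁, e₃, e₄} : Set L) := by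
    intro h
    simp only [Submodule.mem_span_insert, Submodule.mem_span_singleton] at h
    obtain ⟨a, _, ⟨c, _, ⟨d, rfl⟩, rfl⟩, h⟩ := h
    have := Fintype.linearIndependent_iff.mp hli ![a, -1, c, d] (by
      simp only [Fin.sum_univ_four, Matrix.cons_val]
      rw [← sub_eq_zero.mpr h.symm]
      module) 1
    norm_num at this
  have ideal_of_components (q : Submodule ℝ L) (h₄ : e₄ ∈ q)
      (hq : q ≤ Submodule.span ℝ ({e₁, e₃, e₄} : Set L))
      (hc : ∀ y ∈ q, ∃ a c d : ℝ, y = a • e₁ + c • e₃ + d • e₄ ∧ a • e₁ ∈ q ∧ c • e₃ ∈ q) :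
      (∀ x : L, ∀ y ∈ q, ⁅x, y⁆ ∈ q) ∧ q ≠ ⊥ ∧ q ≠ ⊤ := by
    refine ⟨fun x y hy => ?_, ?_, ?_⟩
    · obtain ⟨a, c, d, rfl, h₁, h₃⟩ := hc y hy
      obtain ⟨x₁, x₂, x₃, x₄, rfl⟩ := coords x
      have key : ⁅x₁ • e₁ + x₂ • e₂ + x₃ • e₃ + x₄ • e₄, a • e₁ + c • e₃ + d • e₄⁆ =
          (2 * x₂) • a • e₁ + (-3 * x₂) • c • e₃ + (x₃ * a - x₁ * c - x₂ * d) • e₄ := by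
        simp only [add_lie, lie_add, smul_lie, lie_smul, lie_self, h13, h14, h21, h23, h24, h31,
          h34, h41, h43]
        module
      rw [key]
      exact add_mem (add_mem (q.smul_mem _ h₁) (q.smul_mem _ h₃)) (q.smul_mem _ h₄)
    · rintro rfl
      exact he₄ ((Submodule.mem_bot ℝ).mp h₄)
    · rintro rfl
      exact he₂ (hq Submodule.mem_top)
  intro p
  constructor
  · rintro ⟨hp, hbot, htop⟩
    have components (a b c d : ℝ) (hy : a • e₁ + b • e₂ + c • e₃ + d • e₄ ∈ p) :
        a • e₁ ∈ p ∧ b • e₂ ∈ p ∧ c • e₃ ∈ p ∧ d • e₄ ∈ p := by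
      have ad_e₂ (a b c d : ℝ) : ⁅e₂, a • e₁ + b • e₂ + c • e₃ + d • e₄⁆ =
          (2 * a) • e₁ + (0 : ℝ) • e₂ + (-3 * c) • e₃ + (-d) • e₄ := by
        simp only [lie_add, lie_smul, lie_self, h21, h23, h24]
        module
      have hD := hp e₂ _ hy
      rw [ad_e₂] at hD
      have hD2 := hp e₂ _ hD
      rw [ad_e₂] at hD2
      have hD3 := hp e₂ _ hD2
      rw [ad_e₂] at hD3
      have comb (r s t : ℝ) := add_mem (add_mem (p.smul_mem r hD) (p.smul_mem s hD2))
        (p.smul_mem t hD3)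
      have ha : a • e₁ ∈ p := by
        convert comb (3 / 30) (4 / 30) (1 / 30) using 1
        module
      have hc : c • e₃ ∈ p := by
        convert comb (2 / 30) (1 / 30) (-1 / 30) using 1
        module
      have hd : d • e₄ ∈ p := by
        convert comb (-6 / 6) (1 / 6) (1 / 6) using 1
        module
      refine ⟨ha, ?_, hc, hd⟩
      convert sub_mem (sub_mem (sub_mem hy ha) hc) hd using 1
      module
    have mem_or {a : ℝ} {e : L} (h : a • e ∈ p) : a = 0 ∨ e ∈ p :=
      or_iff_not_imp_left.mpr fun ha => (p.smul_mem_iff ha).mp h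
    have h₁₄ (h : e₁ ∈ p) : e₄ ∈ p := h31 ▸ hp e₃ _ h
    have h₃₄ (h : e₃ ∈ p) : e₄ ∈ p := by simpa [h13] using hp e₁ _ h
    have h₂ : e₂ ∉ p := by
      intro h
      have h₁ : e₁ ∈ p := (p.smul_mem_iff (by norm_num)).mp (h12 ▸ hp e₁ _ h)
      have h₃ : e₃ ∈ p := (p.smul_mem_iff (by norm_num)).mp (h32 ▸ hp e₃ _ h)
      refine htop (top_le_iff.mp (hspan ▸ Submodule.span_le.mpr ?_))
      simp [Set.insert_subset_iff, h₁, h, h₃, h₁₄ h₁]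
    have decomp (y : L) (hy : y ∈ p) : ∃ a c d : ℝ, y = a • e₁ + c • e₃ + d • e₄ ∧
        (a = 0 ∨ e₁ ∈ p) ∧ (c = 0 ∨ e₃ ∈ p) ∧ (d = 0 ∨ e₄ ∈ p) := by
      obtain ⟨a, b, c, d, rfl⟩ := coords y
      obtain ⟨ha, hb, hc, hd⟩ := components a b c d hy
      obtain rfl := (mem_or hb).resolve_right h₂
      exact ⟨a, c, d, by module, mem_or ha, mem_or hc, mem_or hd⟩
    have h₄ : e₄ ∈ p := by
      obtain ⟨y, hy, hy0⟩ := p.ne_bot_iff.mp hbot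
      obtain ⟨a, c, d, rfl, ha, hc, hd⟩ := decomp y hy
      by_contra h
      obtain rfl := ha.resolve_right (mt h₁₄ h)
      obtain rfl := hc.resolve_right (mt h₃₄ h)
      obtain rfl := hd.resolve_right h
      exact hy0 (by module)
    have eq_span (s : Set L) (hs : s ⊆ p) (hs₁ : e₁ ∈ p → e₁ ∈ s) (hs₃ : e₃ ∈ p → e₃ ∈ s)
        (hs₄ : e₄ ∈ s) : p = Submodule.span ℝ s := by
      refine le_antisymm (fun y hy => ?_) (Submodule.span_le.mpr hs)
      obtain ⟨a, c, d, rfl, ha, hc, -⟩ := decomp y hy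
      have smul_mem {r : ℝ} {e : L} (hr : r = 0 ∨ e ∈ p) (he : e ∈ p → e ∈ s) :
          r • e ∈ Submodule.span ℝ s := by
        rcases hr with rfl | h
        · simp
        · exact Submodule.smul_mem _ _ (Submodule.subset_span (he h))
      exact add_mem (add_mem (smul_mem ha hs₁) (smul_mem hc hs₃))
        (smul_mem (.inr h₄) fun _ => hs₄)
    by_cases h₁ : e₁ ∈ p <;> by_cases h₃ : e₃ ∈ p
    · refine .inr (.inr (.inr (eq_span _ ?_ ?_ ?_ ?_))) <;>
        simp [Set.insert_subset_iff, h₁, h₃, h₄]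
    · refine .inr (.inl (eq_span _ ?_ ?_ ?_ ?_)) <;> simp [Set.insert_subset_iff, h₁, h₃, h₄]
    · refine .inr (.inr (.inl (eq_span _ ?_ ?_ ?_ ?_))) <;>
        simp [Set.insert_subset_iff, h₁, h₃, h₄]
    · refine .inl (eq_span _ ?_ ?_ ?_ ?_) <;> simp [h₁, h₃, h₄]
  · have mem_span {s : Set L} {e : L} (he : e ∈ s) (r : ℝ) : r • e ∈ Submodule.span ℝ s :=
      Submodule.smul_mem _ _ (Submodule.subset_span he)
    rintro (rfl | rfl | rfl | rfl) <;>
      refine ideal_of_components _ (Submodule.subset_span (by simp))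
        (Submodule.span_mono (by simp [Set.insert_subset_iff])) fun y hy => ?_
    · obtain ⟨d, rfl⟩ := Submodule.mem_span_singleton.mp hy
      exact ⟨0, 0, d, by module, by simp, by simp⟩
    · obtain ⟨a, d, rfl⟩ := Submodule.mem_span_pair.mp hy
      exact ⟨a, 0, d, by module, mem_span (by simp) a, by simp⟩
    · obtain ⟨c, d, rfl⟩ := Submodule.mem_span_pair.mp hy
      exact ⟨0, c, d, by module, by simp, mem_span (by simp) c⟩
    · obtain ⟨a, c, d, rfl⟩ := Submodule.mem_span_triple.mp hy
      exact ⟨a, c, d, rfl, mem_span (by simp) a, mem_span (by simp) c⟩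
end
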